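/- Under the hypotheses of the pointwise inequality (Ω ∈ L^ρ(𝕊^{n-1}), 1 < ρ < n, mean zero; α ≥ ρn/(ρn+ρ−n); 1 < α < β < n), suppose f : ℝⁿ → ℝ satisfies ∇f ∈ Ṁ^{α, αn/β}(ℝⁿ) and ∇f ∈ L^p(ℝⁿ) with α < p < ∞. Set q = p/(1 − α/β). Then ‖T_Ω f‖_{L^q} ≤ C ‖Ω‖_{L^ρ(𝕊^{n-1})} ‖∇f‖_{Ṁ^{α, αn/β}}^{α/β} ‖∇f‖_{L^p}^{1−α/β}. -/

import Mathlib

open MeasureTheory Metric Set ENNReal Filter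

noncomputable def morreyNorm (n : ℕ) (p q : ℝ) (f : EuclideanSpace ℝ (Fin n) → ℝ) : ℝ≥0∞ :=
  ⨆ (x : EuclideanSpace ℝ (Fin n)) (r : ℝ) (_ : 0 < r),
    (ENNReal.ofReal (r ^ (-((n : ℝ) * (1 - p / q)))) *
      ∫⁻ y in ball x r, ENNReal.ofReal (|f y| ^ p)) ^ (1 / p)

section Maximal

variable {E : Type*} [NormedAddCommGroup E] [MeasurableSpace E]

/-- The uncentered Hardy–Littlewood maximal function. -/
noncomputable def maximalFunction (μ : Measure E) (h : E → ℝ≥0∞) (x : E) : ℝ≥0∞ :=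
  ⨆ (c : E) (r : ℝ) (_ : x ∈ ball c r), ⨍⁻ y in ball c r, h y ∂μ

theorem laverage_ball_le_maximalFunction (μ : Measure E) (h : E → ℝ≥0∞) {x c : E} {r : ℝ}
    (hx : x ∈ ball c r) : ⨍⁻ y in ball c r, h y ∂μ ≤ maximalFunction μ h x :=
  le_iSup₂_of_le c r (le_iSup_of_le hx le_rfl)

theorem lt_maximalFunction_iff {μ : Measure E} {h : E → ℝ≥0∞} {x : E} {t : ℝ≥0∞} :
    t < maximalFunction μ h x ↔ ∃ c r, x ∈ ball c r ∧ t < ⨍⁻ y in ball c r, h y ∂μ := by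
  simp only [maximalFunction, lt_iSup_iff, exists_prop]

theorem isOpen_lt_maximalFunction (μ : Measure E) (h : E → ℝ≥0∞) (t : ℝ≥0∞) :
    IsOpen {x | t < maximalFunction μ h x} := by
  rw [isOpen_iff_mem_nhds]
  intro x hx
  obtain ⟨c, r, hxc, hc⟩ := lt_maximalFunction_iff.1 hx
  filter_upwards [isOpen_ball.mem_nhds hxc] with y hy
  exact lt_maximalFunction_iff.2 ⟨c, r, hy, hc⟩

theorem measurable_maximalFunction [BorelSpace E] (μ : Measure E) (h : E → ℝ≥0∞) :
    Measurable (maximalFunction μ h) :=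
  measurable_of_Ioi fun t => (isOpen_lt_maximalFunction μ h t).measurableSet

variable [BorelSpace E] [NormedSpace ℝ E] [FiniteDimensional ℝ E] [Nontrivial E]
  (μ : Measure E) [μ.IsAddHaarMeasure]

/-- Weak type `(1,1)` bound for the maximal function. -/
theorem measure_lt_maximalFunction_le (h : E → ℝ≥0∞) {t : ℝ≥0∞} (ht : t ≠ 0) (ht' : t ≠ ∞) :
    μ {x | t < maximalFunction μ h x} ≤
      4 ^ Module.finrank ℝ E * (t⁻¹ * ∫⁻ y, h y ∂μ) := by
  rcases eq_or_ne (∫⁻ y, h y ∂μ) ∞ with hI | hI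
  · rw [hI, ENNReal.mul_top (by simpa using ht'), ENNReal.mul_top (by simp)]
    exact le_top
  set d := Module.finrank ℝ E with hd
  have hd0 : d ≠ 0 := Module.finrank_pos.ne'
  let T : Set (E × ℝ) := {b | 0 < b.2 ∧ t < ⨍⁻ y in ball b.1 b.2, h y ∂μ}
  have hT : ∀ b ∈ T, μ (ball b.1 b.2) ≤ t⁻¹ * ∫⁻ y in ball b.1 b.2, h y ∂μ := by
    rintro b ⟨hb, hbt⟩
    rw [setLAverage_eq, ENNReal.lt_div_iff_mul_lt (Or.inl (measure_ball_pos μ _ hb).ne')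
      (Or.inl measure_ball_lt_top.ne)] at hbt
    rw [mul_comm, ← div_eq_mul_inv, ENNReal.le_div_iff_mul_le (Or.inl ht) (Or.inl ht'), mul_comm]
    exact hbt.le
  have hB1 : μ (ball (0 : E) 1) ≠ 0 := (measure_ball_pos μ _ one_pos).ne'
  set K : ℝ≥0∞ := (t⁻¹ * ∫⁻ y, h y ∂μ) / μ (ball (0 : E) 1) with hK
  have hKt : K ≠ ∞ := ENNReal.div_ne_top (ENNReal.mul_ne_top (by simpa using ht) hI) hB1
  obtain ⟨u, huT, hud, huc⟩ := Vitali.exists_disjoint_subfamily_covering_enlargement_ball T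
    Prod.fst Prod.snd (max 1 K.toReal) (by
      intro b hb
      rcases le_total b.2 1 with h1 | h1
      · exact le_max_of_le_left h1
      · refine le_max_of_le_right ((le_self_pow₀ h1 hd0).trans ?_)
        refine (ENNReal.ofReal_le_iff_le_toReal hKt).1 ?_
        rw [hK, ENNReal.le_div_iff_mul_le (Or.inl hB1) (Or.inl measure_ball_lt_top.ne),
          ← Measure.addHaar_ball_of_pos μ b.1 hb.1]
        refine (hT b hb).trans ?_
        gcongr
        exact Measure.restrict_le_self) 4 (by norm_num)
  have hucount : u.Countable := hud.countable_of_isOpen (fun _ _ => isOpen_ball)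
    fun b hb => nonempty_ball.2 (huT hb).1
  calc μ {x | t < maximalFunction μ h x}
      ≤ μ (⋃ b ∈ u, ball b.1 (4 * b.2)) := by
        refine measure_mono fun x hx => ?_
        obtain ⟨c, r, hxc, hc⟩ := lt_maximalFunction_iff.1 hx
        obtain ⟨b, hb, hsub⟩ := huc (c, r) ⟨pos_of_mem_ball hxc, hc⟩
        exact mem_biUnion hb (hsub hxc)
    _ ≤ ∑' b : u, μ (ball b.1.1 (4 * b.1.2)) := measure_biUnion_le _ hucount _
    _ ≤ ∑' b : u, 4 ^ d * (t⁻¹ * ∫⁻ y in ball b.1.1 b.1.2, h y ∂μ) := by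
        refine ENNReal.tsum_le_tsum fun b => ?_
        rw [Measure.addHaar_ball_mul_of_pos μ _ (by norm_num), ← hd,
          ENNReal.ofReal_pow (by norm_num), ENNReal.ofReal_ofNat,
          ← Measure.addHaar_ball_center μ b.1.1]
        gcongr
        exact hT _ (huT b.2)
    _ = 4 ^ d * (t⁻¹ * ∫⁻ y in ⋃ b ∈ u, ball b.1 b.2, h y ∂μ) := by
        rw [ENNReal.tsum_mul_left, ENNReal.tsum_mul_left,
          lintegral_biUnion hucount (fun _ _ => measurableSet_ball) hud]
    _ ≤ _ := by
        gcongr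
        exact Measure.restrict_le_self

theorem lintegral_Ioo_rpow {p b : ℝ} (hp : 0 < p) (hb : 0 ≤ b) :
    ∫⁻ t in Ioo 0 b, ENNReal.ofReal (p * t ^ (p - 1)) = ENNReal.ofReal (b ^ p) := by
  have hi : IntervalIntegrable (fun t : ℝ => p * t ^ (p - 1)) volume 0 b :=
    (intervalIntegral.intervalIntegrable_rpow' (by linarith)).const_mul p
  rw [Measure.restrict_congr_set Ioo_ae_eq_Ioc, ← ofReal_integral_eq_lintegral_ofReal hi.1,
    ← intervalIntegral.integral_of_le hb, intervalIntegral.integral_const_mul,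
    integral_rpow (Or.inl (by linarith))]
  · congr 1
    rw [sub_add_cancel, Real.zero_rpow hp.ne']
    field_simp
    simp
  · filter_upwards [ae_restrict_mem measurableSet_Ioc] with t ht
    have := ht.1.le
    positivity

theorem rpow_le_lintegral_indicator {p : ℝ} (hp : 0 < p) (a : ℝ≥0∞) :
    a ^ p ≤ ∫⁻ t in Ioi 0,
      ENNReal.ofReal (p * t ^ (p - 1)) * {t | ENNReal.ofReal t < a}.indicator 1 t := by
  have key : ∀ b : ℝ, 0 ≤ b → ENNReal.ofReal b ≤ a → ENNReal.ofReal b ^ p ≤ ∫⁻ t in Ioi 0,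
      ENNReal.ofReal (p * t ^ (p - 1)) * {t | ENNReal.ofReal t < a}.indicator 1 t := by
    intro b hb hba
    rw [ENNReal.ofReal_rpow_of_nonneg hb hp.le, ← lintegral_Ioo_rpow hp hb]
    calc _ = ∫⁻ t in Ioo 0 b,
          ENNReal.ofReal (p * t ^ (p - 1)) * {t | ENNReal.ofReal t < a}.indicator 1 t := by
          refine setLIntegral_congr_fun measurableSet_Ioo fun t ht => ?_
          have : ENNReal.ofReal t < a :=
            ((ENNReal.ofReal_lt_ofReal_iff (ht.1.trans ht.2)).2 ht.2).trans_le hba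
          simp [this]
      _ ≤ _ := lintegral_mono_set Ioo_subset_Ioi_self
  rcases eq_or_ne a ∞ with rfl | ha
  · rw [ENNReal.top_rpow_of_pos hp]
    refine le_of_eq (ENNReal.eq_top_of_forall_nnreal_le fun r => ?_).symm
    have := key ((r : ℝ) ^ (1 / p)) (by positivity) le_top
    rw [ENNReal.ofReal_rpow_of_nonneg (by positivity) hp.le, ← Real.rpow_mul r.coe_nonneg,
      one_div_mul_cancel hp.ne', Real.rpow_one] at this
    simpa using this
  · simpa [ha] using key a.toReal ENNReal.toReal_nonneg (by simp [ha])

theorem lintegral_indicator_ofReal_lt_le {p : ℝ} (hp : 0 < p) (a : ℝ≥0∞) :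
    ∫⁻ t in Ioi 0, ENNReal.ofReal (p * t ^ (p - 1)) * {t | ENNReal.ofReal t < a}.indicator 1 t
      ≤ a ^ p := by
  rcases eq_or_ne a ∞ with rfl | ha
  · simp [hp]
  · calc _ ≤ ∫⁻ t in Ioi 0, (Ioo 0 a.toReal).indicator
            (fun t => ENNReal.ofReal (p * t ^ (p - 1))) t := by
          refine setLIntegral_mono' measurableSet_Ioi fun t ht => ?_
          by_cases hta : ENNReal.ofReal t < a
          · have : t ∈ Ioo 0 a.toReal :=
              ⟨ht, (ENNReal.ofReal_lt_iff_lt_toReal (le_of_lt ht) ha).1 hta⟩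
            simp [this, hta]
          · simp [hta]
      _ = ∫⁻ t in Ioo 0 a.toReal, ENNReal.ofReal (p * t ^ (p - 1)) := by
          rw [setLIntegral_indicator measurableSet_Ioo,
            inter_eq_left.2 Ioo_subset_Ioi_self]
      _ = a ^ p := by
          rw [lintegral_Ioo_rpow hp ENNReal.toReal_nonneg,
            ← ENNReal.ofReal_rpow_of_nonneg ENNReal.toReal_nonneg hp.le, ENNReal.ofReal_toReal ha]
      _ ≤ _ := le_rfl

theorem measure_lt_maximalFunction_le_setLIntegral {h : E → ℝ≥0∞} (hm : Measurable h)
    {t : ℝ} (ht : 0 < t) :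
    μ {x | ENNReal.ofReal t < maximalFunction μ h x} ≤
      4 ^ Module.finrank ℝ E *
        (ENNReal.ofReal (2 / t) * ∫⁻ y in {y | ENNReal.ofReal t < 2 * h y}, h y ∂μ) := by
  have ht2 : ENNReal.ofReal (t / 2) ≠ 0 := by simpa using ht
  have h2 : ENNReal.ofReal t = 2 * ENNReal.ofReal (t / 2) := by
    rw [← ENNReal.ofReal_ofNat, ← ENNReal.ofReal_mul (by norm_num)]
    congr 1; ring
  have hs : MeasurableSet {y | ENNReal.ofReal t < 2 * h y} :=
    measurableSet_lt measurable_const (hm.const_mul 2)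
  set k := {y | ENNReal.ofReal t < 2 * h y}.indicator h with hk
  have hle : ∀ y, h y ≤ k y + ENNReal.ofReal (t / 2) := by
    intro y
    by_cases hy : ENNReal.ofReal t < 2 * h y
    · simp [hk, hy]
    · rw [not_lt, h2] at hy
      exact le_add_left ((ENNReal.mul_le_mul_iff_right (by norm_num) (by norm_num)).1 hy)
  calc _ ≤ μ {x | ENNReal.ofReal (t / 2) < maximalFunction μ k x} := by
        refine measure_mono fun x hx => ?_
        obtain ⟨c, r, hxc, hc⟩ := lt_maximalFunction_iff.1 hx
        refine lt_maximalFunction_iff.2 ⟨c, r, hxc, ?_⟩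
        have h0 : μ (ball c r) ≠ 0 := (measure_ball_pos μ _ (pos_of_mem_ball hxc)).ne'
        have h1 : μ (ball c r) ≠ ∞ := measure_ball_lt_top.ne
        have : ⨍⁻ y in ball c r, h y ∂μ
            ≤ (⨍⁻ y in ball c r, k y ∂μ) + ENNReal.ofReal (t / 2) := by
          rw [setLAverage_eq, setLAverage_eq]
          calc _ ≤ (∫⁻ y in ball c r, k y + ENNReal.ofReal (t / 2) ∂μ) / μ (ball c r) := by
                gcongr with y
                exact hle y
            _ = _ := by
                rw [lintegral_add_right _ measurable_const, setLIntegral_const, ENNReal.add_div,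
                  ENNReal.mul_div_cancel_right h0 h1]
        rw [h2, two_mul] at hc
        exact lt_of_add_lt_add_right (hc.trans_le this)
    _ ≤ _ := measure_lt_maximalFunction_le μ k ht2 ENNReal.ofReal_ne_top
    _ = _ := by
        rw [lintegral_indicator hs, ← ENNReal.ofReal_inv_of_pos (by positivity), inv_div]

/-- The Hardy–Littlewood maximal theorem: strong type `(p,p)` for `1 < p`. -/
theorem exists_lintegral_maximalFunction_rpow_le {p : ℝ} (hp : 1 < p) :
    ∃ C : ℝ≥0∞, C ≠ ∞ ∧ ∀ h : E → ℝ≥0∞, Measurable h →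
      ∫⁻ x, maximalFunction μ h x ^ p ∂μ ≤ C * ∫⁻ x, h x ^ p ∂μ := by
  have hp0 : 0 < p := by linarith
  have hp1 : 0 < p - 1 := by linarith
  set c : ℝ≥0∞ := 4 ^ Module.finrank ℝ E * ENNReal.ofReal (2 * p / (p - 1)) with hc
  refine ⟨c * 2 ^ (p - 1), by finiteness, fun h hm => ?_⟩
  have hmM := measurable_maximalFunction μ h
  have hset1 : MeasurableSet {z : E × ℝ | ENNReal.ofReal z.2 < maximalFunction μ h z.1} :=
    measurableSet_lt (by fun_prop) (by fun_prop)
  have hset2 : MeasurableSet {z : ℝ × E | ENNReal.ofReal z.1 < 2 * h z.2} :=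
    measurableSet_lt (by fun_prop) (by fun_prop)
  calc ∫⁻ x, maximalFunction μ h x ^ p ∂μ
      ≤ ∫⁻ x, (∫⁻ t in Ioi 0, ENNReal.ofReal (p * t ^ (p - 1)) *
          {t | ENNReal.ofReal t < maximalFunction μ h x}.indicator 1 t) ∂μ :=
        lintegral_mono fun x => rpow_le_lintegral_indicator hp0 _
    _ = ∫⁻ t in Ioi 0, ∫⁻ x, ENNReal.ofReal (p * t ^ (p - 1)) *
          {t | ENNReal.ofReal t < maximalFunction μ h x}.indicator 1 t ∂μ := by
        refine lintegral_lintegral_swap (Measurable.aemeasurable ?_)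
        have := (measurable_one (α := ℝ≥0∞)).indicator hset1
        refine Measurable.mul (by fun_prop) ?_
        exact this
    _ ≤ ∫⁻ t in Ioi 0, ∫⁻ x, c * (ENNReal.ofReal ((p - 1) * t ^ (p - 1 - 1)) *
          {t | ENNReal.ofReal t < 2 * h x}.indicator 1 t * h x) ∂μ := by
        refine setLIntegral_mono' measurableSet_Ioi fun t ht => ?_
        have ht : 0 < t := ht
        have e1 : ∀ x, {t | ENNReal.ofReal t < maximalFunction μ h x}.indicator (1 : ℝ → ℝ≥0∞) t =
          {x | ENNReal.ofReal t < maximalFunction μ h x}.indicator 1 x := fun x => rfl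
        have e2 : ∀ x, ENNReal.ofReal ((p - 1) * t ^ (p - 1 - 1)) *
            {t | ENNReal.ofReal t < 2 * h x}.indicator (1 : ℝ → ℝ≥0∞) t * h x =
          ENNReal.ofReal ((p - 1) * t ^ (p - 1 - 1)) *
            {x | ENNReal.ofReal t < 2 * h x}.indicator h x := by
          intro x
          by_cases hx : ENNReal.ofReal t < 2 * h x <;> simp [hx]
        simp_rw [e1, e2]
        rw [lintegral_const_mul' _ _ ENNReal.ofReal_ne_top,
          lintegral_indicator_one (isOpen_lt_maximalFunction μ h _).measurableSet,
          lintegral_const_mul' _ _ (by finiteness),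
          lintegral_const_mul' _ _ ENNReal.ofReal_ne_top,
          lintegral_indicator (measurableSet_lt measurable_const (hm.const_mul 2))]
        refine (mul_le_mul_right (measure_lt_maximalFunction_le_setLIntegral μ hm ht) _).trans ?_
        have e3 : ENNReal.ofReal (p * t ^ (p - 1)) * ENNReal.ofReal (2 / t) =
            ENNReal.ofReal (2 * p / (p - 1)) * ENNReal.ofReal ((p - 1) * t ^ (p - 1 - 1)) := by
          rw [← ENNReal.ofReal_mul (by positivity), ← ENNReal.ofReal_mul (by positivity)]
          congr 1
          rw [Real.rpow_sub_one ht.ne' (p - 1)]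
          field_simp
        rw [hc]
        calc _ = 4 ^ Module.finrank ℝ E * (ENNReal.ofReal (p * t ^ (p - 1)) *
              ENNReal.ofReal (2 / t)) * ∫⁻ y in {y | ENNReal.ofReal t < 2 * h y}, h y ∂μ := by ring
          _ ≤ _ := by rw [e3]; exact le_of_eq (by ring)
    _ = ∫⁻ x, (∫⁻ t in Ioi 0, c * (ENNReal.ofReal ((p - 1) * t ^ (p - 1 - 1)) *
          {t | ENNReal.ofReal t < 2 * h x}.indicator 1 t * h x)) ∂μ := by
        refine lintegral_lintegral_swap (Measurable.aemeasurable ?_)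
        have := (measurable_one (α := ℝ≥0∞)).indicator hset2
        refine Measurable.const_mul (Measurable.mul (Measurable.mul (by fun_prop) ?_)
          (by fun_prop)) _
        exact this
    _ ≤ ∫⁻ x, c * ((2 * h x) ^ (p - 1) * h x) ∂μ := by
        refine lintegral_mono fun x => ?_
        have hmi : Measurable fun t : ℝ => ENNReal.ofReal ((p - 1) * t ^ (p - 1 - 1)) *
          {t | ENNReal.ofReal t < 2 * h x}.indicator 1 t := by
          refine Measurable.mul (by fun_prop) (measurable_one.indicator ?_)
          exact measurableSet_lt (by fun_prop) (by fun_prop)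
        dsimp only
        rw [lintegral_const_mul' _ _ (by finiteness), lintegral_mul_const _ hmi]
        gcongr
        exact lintegral_indicator_ofReal_lt_le hp1 _
    _ = c * 2 ^ (p - 1) * ∫⁻ x, h x ^ p ∂μ := by
        rw [← lintegral_const_mul _ (by fun_prop)]
        refine lintegral_congr fun x => ?_
        have hx : h x ^ p = h x ^ (p - 1) * h x := by
          conv_rhs => rw [← ENNReal.rpow_one (h x), ← ENNReal.rpow_mul, one_mul]
          rw [← ENNReal.rpow_add_of_nonneg _ _ hp1.le zero_le_one, sub_add_cancel]
        rw [ENNReal.mul_rpow_of_nonneg _ _ hp1.le, hx]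
        ring

end Maximal

section MinBounds

theorem exists_lintegral_min_rpow_le {κ : ℝ} (hκ : 1 < κ) :
    ∃ C : ℝ≥0∞, C ≠ ∞ ∧ ∀ a b : ℝ≥0∞,
      ∫⁻ s in Ioi (0 : ℝ), min a (ENNReal.ofReal (s ^ (-κ)) * b) ≤
        C * (a ^ (1 - 1 / κ) * b ^ (1 / κ)) := by
  have hκ0 : 0 < κ := by linarith
  have hκ1 : 0 < κ - 1 := by linarith
  have hi : 0 < 1 / κ := by positivity
  have hi1 : 0 < 1 - 1 / κ := by rw [sub_pos, div_lt_one hκ0]; exact hκ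
  refine ⟨ENNReal.ofReal (1 + 1 / (κ - 1)), ENNReal.ofReal_ne_top, fun a b => ?_⟩
  have hC : ENNReal.ofReal (1 + 1 / (κ - 1)) ≠ 0 := by simp; positivity
  rcases eq_or_ne a 0 with rfl | ha0
  · simp
  rcases eq_or_ne b 0 with rfl | hb0
  · simp
  rcases eq_or_ne a ∞ with rfl | ha
  · rw [ENNReal.top_rpow_of_pos hi1, ENNReal.top_mul (by simp [hb0, hκ0.le]),
      ENNReal.mul_top hC]
    exact le_top
  rcases eq_or_ne b ∞ with rfl | hb
  · rw [ENNReal.top_rpow_of_pos hi, ENNReal.mul_top (by simp [ha0, ha]), ENNReal.mul_top hC]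
    exact le_top
  lift a to NNReal using ha
  lift b to NNReal using hb
  have ha0 : (0 : ℝ) < a := by
    rw [NNReal.coe_pos, pos_iff_ne_zero]; exact_mod_cast ha0
  have hb0 : (0 : ℝ) < b := by
    rw [NNReal.coe_pos, pos_iff_ne_zero]; exact_mod_cast hb0
  set l : ℝ := (b / a : ℝ) ^ (1 / κ) with hl
  have hl0 : 0 < l := by positivity
  have hlκ : l ^ κ = b / a := by
    rw [hl, ← Real.rpow_mul (by positivity), one_div_mul_cancel hκ0.ne', Real.rpow_one]
  have hla : l * a = (a : ℝ) ^ (1 - 1 / κ) * (b : ℝ) ^ (1 / κ) := by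
    rw [hl, Real.div_rpow hb0.le ha0.le, Real.rpow_sub ha0, Real.rpow_one]
    ring
  have e : ((a : ℝ≥0∞)) ^ (1 - 1 / κ) * (b : ℝ≥0∞) ^ (1 / κ) = ENNReal.ofReal (l * a) := by
    rw [hla, ENNReal.ofReal_mul (by positivity), ← ENNReal.ofReal_rpow_of_pos ha0,
      ← ENNReal.ofReal_rpow_of_pos hb0, ENNReal.ofReal_coe_nnreal, ENNReal.ofReal_coe_nnreal]
  calc _ = ∫⁻ s in Ioc 0 l ∪ Ioi l, min (a : ℝ≥0∞) (ENNReal.ofReal (s ^ (-κ)) * b) := by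
        rw [Ioc_union_Ioi_eq_Ioi hl0.le]
    _ ≤ (∫⁻ s in Ioc 0 l, min (a : ℝ≥0∞) (ENNReal.ofReal (s ^ (-κ)) * b)) +
          ∫⁻ s in Ioi l, min (a : ℝ≥0∞) (ENNReal.ofReal (s ^ (-κ)) * b) :=
        lintegral_union_le _ _ _
    _ ≤ (∫⁻ _ in Ioc 0 l, (a : ℝ≥0∞)) + ∫⁻ s in Ioi l, ENNReal.ofReal (s ^ (-κ)) * b := by
        gcongr
        · exact min_le_left _ _
        · exact min_le_right _ _
    _ = ENNReal.ofReal (l * a) + ENNReal.ofReal (l * a / (κ - 1)) := by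
        congr 1
        · rw [setLIntegral_const, Real.volume_Ioc, sub_zero, mul_comm,
            ENNReal.ofReal_mul hl0.le, ENNReal.ofReal_coe_nnreal]
        · rw [lintegral_mul_const' _ _ ENNReal.coe_ne_top, ← ofReal_integral_eq_lintegral_ofReal
            (integrableOn_Ioi_rpow_of_lt (by linarith) hl0), integral_Ioi_rpow_of_lt (by linarith)
            hl0, ← ENNReal.ofReal_coe_nnreal, ← ENNReal.ofReal_mul]
          · congr 1
            rw [Real.rpow_add hl0, Real.rpow_neg hl0.le, hlκ, Real.rpow_one,
              show -κ + 1 = -(κ - 1) by ring]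
            field_simp
          · rw [show -κ + 1 = -(κ - 1) by ring, neg_div_neg_eq]
            positivity
          · filter_upwards [ae_restrict_mem measurableSet_Ioi] with s hs
            have : 0 < s := hl0.trans hs
            positivity
    _ ≤ _ := by
        rw [e, ← ENNReal.ofReal_add (by positivity) (by positivity),
          ← ENNReal.ofReal_mul (by positivity)]
        refine le_of_eq (congrArg _ ?_)
        ring

theorem summable_min_two_zpow {b : ℝ} (hb : 1 < b) :
    Summable fun j : ℤ => min ((2 : ℝ) ^ j) (((2 : ℝ) ^ j) ^ (1 - b)) := by
  refine Summable.of_nat_of_neg ?_ ?_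
  · refine Summable.of_nonneg_of_le (fun n => by positivity) (fun n => min_le_right _ _) ?_
    have : (2 : ℝ) ^ (1 - b) < 1 := Real.rpow_lt_one_of_one_lt_of_neg (by norm_num) (by linarith)
    refine (summable_geometric_of_lt_one (by positivity) this).congr fun n => ?_
    rw [zpow_natCast, ← Real.rpow_natCast, ← Real.rpow_natCast, ← Real.rpow_mul (by norm_num),
      ← Real.rpow_mul (by norm_num), mul_comm]
  · refine Summable.of_nonneg_of_le (fun n => by positivity) (fun n => min_le_left _ _) ?_
    refine (summable_geometric_of_lt_one (r := (1 / 2 : ℝ)) (by norm_num) (by norm_num)).congr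
      fun n => ?_
    simp

theorem exists_tsum_min_two_zpow_le {b : ℝ} (hb : 1 < b) :
    ∃ C : ℝ≥0∞, C ≠ ∞ ∧ ∀ A N : ℝ≥0∞, ∃ l : ℝ, 0 < l ∧
      ∑' j : ℤ, min (ENNReal.ofReal (l * 2 ^ j) * A) (ENNReal.ofReal ((l * 2 ^ j) ^ (1 - b)) * N)
        ≤ C * (A ^ (1 - 1 / b) * N ^ (1 / b)) := by
  have hb0 : 0 < b := by linarith
  have hi : 0 < 1 / b := by positivity
  have hi1 : 0 < 1 - 1 / b := by rw [sub_pos, div_lt_one hb0]; exact hb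
  have hsum := summable_min_two_zpow hb
  have hpos : 0 < ∑' j : ℤ, min ((2 : ℝ) ^ j) (((2 : ℝ) ^ j) ^ (1 - b)) :=
    hsum.tsum_pos (fun j => by positivity) 0 (by simp)
  set S := ∑' j : ℤ, min ((2 : ℝ) ^ j) (((2 : ℝ) ^ j) ^ (1 - b)) with hS
  have hC : ENNReal.ofReal S ≠ 0 := by simpa using hpos
  refine ⟨ENNReal.ofReal S, ENNReal.ofReal_ne_top, fun a b' => ?_⟩
  rcases eq_or_ne a 0 with rfl | ha0
  · exact ⟨1, one_pos, by simp⟩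
  rcases eq_or_ne b' 0 with rfl | hb0'
  · exact ⟨1, one_pos, by simp⟩
  rcases eq_or_ne a ∞ with rfl | ha
  · refine ⟨1, one_pos, ?_⟩
    rw [ENNReal.top_rpow_of_pos hi1, ENNReal.top_mul (by simp [hb0', hb0.le]),
      ENNReal.mul_top hC]
    exact le_top
  rcases eq_or_ne b' ∞ with rfl | hb'
  · refine ⟨1, one_pos, ?_⟩
    rw [ENNReal.top_rpow_of_pos hi, ENNReal.mul_top (by simp [ha0, ha]), ENNReal.mul_top hC]
    exact le_top
  lift a to NNReal using ha
  lift b' to NNReal using hb'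
  have ha0 : (0 : ℝ) < a := by
    rw [NNReal.coe_pos, pos_iff_ne_zero]; exact_mod_cast ha0
  have hb0' : (0 : ℝ) < b' := by
    rw [NNReal.coe_pos, pos_iff_ne_zero]; exact_mod_cast hb0'
  set l : ℝ := (b' / a : ℝ) ^ (1 / b) with hl
  have hl0 : 0 < l := by positivity
  have hlκ : l ^ b = b' / a := by
    rw [hl, ← Real.rpow_mul (by positivity), one_div_mul_cancel hb0.ne', Real.rpow_one]
  have hla : l * a = (a : ℝ) ^ (1 - 1 / b) * (b' : ℝ) ^ (1 / b) := by
    rw [hl, Real.div_rpow hb0'.le ha0.le, Real.rpow_sub ha0, Real.rpow_one]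
    ring
  have e : ((a : ℝ≥0∞)) ^ (1 - 1 / b) * (b' : ℝ≥0∞) ^ (1 / b) = ENNReal.ofReal (l * a) := by
    rw [hla, ENNReal.ofReal_mul (by positivity), ← ENNReal.ofReal_rpow_of_pos ha0,
      ← ENNReal.ofReal_rpow_of_pos hb0', ENNReal.ofReal_coe_nnreal, ENNReal.ofReal_coe_nnreal]
  refine ⟨l, hl0, ?_⟩
  rw [e, hS, ENNReal.ofReal_tsum_of_nonneg (fun j => by positivity) hsum, mul_comm,
    ← ENNReal.tsum_mul_left]
  refine ENNReal.tsum_le_tsum fun j => le_of_eq ?_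
  rw [← ENNReal.ofReal_mul (by positivity), mul_min_of_nonneg _ _ (by positivity),
    ENNReal.ofReal_mono.map_min, ← ENNReal.ofReal_coe_nnreal (p := a),
    ← ENNReal.ofReal_coe_nnreal (p := b'), ← ENNReal.ofReal_mul (by positivity),
    ← ENNReal.ofReal_mul (by positivity)]
  congr 2
  · ring
  · rw [Real.mul_rpow hl0.le (by positivity), Real.rpow_sub hl0, hlκ, Real.rpow_one]
    field_simp

end MinBounds

section Poincare

variable {E : Type*} [NormedAddCommGroup E] [NormedSpace ℝ E]

theorem enorm_sub_le_lintegral_fderiv {f : E → ℝ} (hf : Differentiable ℝ f) (y z : E) :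
    ‖f z - f y‖ₑ ≤ ∫⁻ s in Ioo (0 : ℝ) 1, ‖fderiv ℝ f (y + s • (z - y))‖ₑ * ‖z - y‖ₑ := by
  have hd : ∀ s : ℝ, HasDerivAt (fun s : ℝ => f (y + s • (z - y)))
      (fderiv ℝ f (y + s • (z - y)) (z - y)) s := by
    intro s
    have h1 : HasDerivAt (fun s : ℝ => y + s • (z - y)) (z - y) s := by
      simpa using ((hasDerivAt_id s).smul_const (z - y)).const_add y
    exact (hf _).hasFDerivAt.comp_hasDerivAt s h1
  set φ : ℝ → ℝ := fun s => fderiv ℝ f (y + s • (z - y)) (z - y) with hφ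
  have hle : ∫⁻ s in Ioc (0 : ℝ) 1, ‖φ s‖ₑ ≤
      ∫⁻ s in Ioo (0 : ℝ) 1, ‖fderiv ℝ f (y + s • (z - y))‖ₑ * ‖z - y‖ₑ := by
    rw [← Measure.restrict_congr_set Ioo_ae_eq_Ioc]
    exact lintegral_mono fun s => ContinuousLinearMap.le_opENorm _ _
  rcases eq_or_ne (∫⁻ s in Ioc (0 : ℝ) 1, ‖φ s‖ₑ) ∞ with htop | htop
  · rw [htop, top_le_iff] at hle
    rw [hle]
    exact le_top
  have hm : Measurable φ := by
    have : φ = deriv (fun s : ℝ => f (y + s • (z - y))) := funext fun s => ((hd s).deriv).symm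
    rw [this]
    exact measurable_deriv _
  have h_integ : IntervalIntegrable φ volume 0 1 :=
    (intervalIntegrable_iff_integrableOn_Ioc_of_le zero_le_one).2
      ⟨hm.aestronglyMeasurable, lt_top_iff_ne_top.2 htop⟩
  have := intervalIntegral.integral_eq_sub_of_hasDerivAt (fun s _ => hd s) h_integ
  simp only [one_smul, zero_smul, add_zero, add_sub_cancel] at this
  rw [← this, intervalIntegral.integral_of_le zero_le_one]
  exact (enorm_integral_le_lintegral_enorm _).trans hle

variable [MeasurableSpace E] [FiniteDimensional ℝ E] (μ : Measure E) [μ.IsAddHaarMeasure]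

theorem laverage_ball_le_rpow {h : E → ℝ≥0∞} (hm : Measurable h) {α : ℝ} (hα : 1 < α) (y : E)
    {r : ℝ} (hr : 0 < r) :
    ⨍⁻ v in ball y r, h v ∂μ ≤ μ (ball y r) ^ (-(1 / α)) * (∫⁻ v, h v ^ α ∂μ) ^ (1 / α) := by
  have hB0 : μ (ball y r) ≠ 0 := (measure_ball_pos μ _ hr).ne'
  have hB1 : μ (ball y r) ≠ ∞ := measure_ball_lt_top.ne
  have hpq := Real.HolderConjugate.conjExponent hα
  have := ENNReal.lintegral_mul_le_Lp_mul_Lq (μ.restrict (ball y r)) hpq hm.aemeasurable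
    (aemeasurable_const (b := (1 : ℝ≥0∞)))
  simp only [Pi.mul_apply, mul_one, ENNReal.one_rpow, setLIntegral_const, one_mul] at this
  have he : 1 / α.conjExponent = 1 - 1 / α := by
    have := hpq.inv_add_inv_eq_one
    simp only [one_div]; linarith
  rw [setLAverage_eq, ENNReal.div_le_iff hB0 hB1]
  calc _ ≤ _ := this
    _ ≤ (∫⁻ v, h v ^ α ∂μ) ^ (1 / α) * μ (ball y r) ^ (1 / α.conjExponent) := by
        gcongr
        exact Measure.restrict_le_self
    _ = _ := by
        rw [he, sub_eq_neg_add, ENNReal.rpow_add _ _ hB0 hB1, ENNReal.rpow_one]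
        ring

variable [BorelSpace E]

theorem lintegral_comp_homothety {g : E → ℝ≥0∞} (hg : Measurable g) (y : E) {s : ℝ} (hs : 0 < s) :
    ∫⁻ z, g (y + s • (z - y)) ∂μ =
      ENNReal.ofReal ((s ^ Module.finrank ℝ E)⁻¹) * ∫⁻ z, g z ∂μ := by
  calc ∫⁻ z, g (y + s • (z - y)) ∂μ = ∫⁻ z, g (y + s • z) ∂μ :=
        lintegral_sub_right_eq_self (fun z => g (y + s • z)) y
    _ = ∫⁻ w, g (y + w) ∂(Measure.map (fun z => s • z) μ) := by
        rw [lintegral_map (by fun_prop) (by fun_prop)]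
    _ = _ := by
        rw [Measure.map_addHaar_smul μ hs.ne', lintegral_smul_measure,
          lintegral_add_left_eq_self, abs_of_pos (by positivity), smul_eq_mul]

theorem enorm_sub_setAverage_le {f : E → ℝ} (hf : Differentiable ℝ f) {x y : E} {R : ℝ}
    (hy : y ∈ ball x R) :
    ‖f y - ⨍ z in ball x R, f z ∂μ‖ₑ ≤ 2 ^ Module.finrank ℝ E * ENNReal.ofReal (2 * R) *
      ∫⁻ s in Ioo (0 : ℝ) 1, ⨍⁻ v in ball y (2 * R * s),
        (ball x R).indicator (fun v => ‖fderiv ℝ f v‖ₑ) v ∂μ := by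
  have hR : 0 < R := pos_of_mem_ball hy
  set B := ball x R with hB
  set d := Module.finrank ℝ E with hd
  set h : E → ℝ≥0∞ := B.indicator (fun v => ‖fderiv ℝ f v‖ₑ) with hh
  have hhm : Measurable h := (measurable_fderiv ℝ f).enorm.indicator measurableSet_ball
  have hB0 : μ B ≠ 0 := (measure_ball_pos μ _ hR).ne'
  have hB1 : μ B ≠ ∞ := measure_ball_lt_top.ne
  have hB1' : μ B < ∞ := measure_ball_lt_top
  have : IsFiniteMeasure (μ.restrict B) := isFiniteMeasure_restrict.2 hB1
  have hfi : IntegrableOn f B μ := by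
    refine IntegrableOn.mono_set ?_ (ball_subset_closedBall (x := x) (ε := R))
    have := FiniteDimensional.proper_real E
    exact hf.continuous.continuousOn.integrableOn_compact (isCompact_closedBall x R)
  have hstep : ‖f y - ⨍ z in B, f z ∂μ‖ₑ ≤ ⨍⁻ z in B, ‖f z - f y‖ₑ ∂μ := by
    have : f y - ⨍ z in B, f z ∂μ = ⨍ z in B, (f y - f z) ∂μ := by
      rw [setAverage_eq, setAverage_eq, integral_sub (integrable_const _) hfi, smul_sub,
        setIntegral_const, smul_smul, inv_mul_cancel₀, one_smul]
      exact (ENNReal.toReal_pos hB0 hB1).ne'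
    rw [this]
    simp_rw [enorm_sub_rev (f _) (f y)]
    exact enorm_integral_le_lintegral_enorm _
  refine hstep.trans ?_
  have hpt : ∀ z ∈ B, ‖f z - f y‖ₑ ≤
      ∫⁻ s in Ioo (0 : ℝ) 1, ENNReal.ofReal (2 * R) *
        (ball y (2 * R * s)).indicator h (y + s • (z - y)) := by
    intro z hz
    refine (enorm_sub_le_lintegral_fderiv hf y z).trans ?_
    refine setLIntegral_mono' measurableSet_Ioo fun s hs => ?_
    have hzy : ‖z - y‖ < 2 * R := by
      rw [← dist_eq_norm]
      linarith [dist_triangle_right z y x, mem_ball.1 hz, mem_ball.1 hy]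
    have h1 : y + s • (z - y) ∈ B := by
      have := (convex_ball x R).add_smul_sub_mem hy hz ⟨hs.1.le, hs.2.le⟩
      exact this
    have h2 : y + s • (z - y) ∈ ball y (2 * R * s) := by
      rw [mem_ball, dist_eq_norm, add_sub_cancel_left, norm_smul, Real.norm_of_nonneg hs.1.le,
        mul_comm]
      exact mul_lt_mul_of_pos_right hzy hs.1
    rw [indicator_of_mem h2, hh, indicator_of_mem h1, mul_comm]
    gcongr
    rw [← ofReal_norm]
    exact ENNReal.ofReal_le_ofReal hzy.le
  have hmeas : Measurable fun q : E × ℝ =>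
      (ball y (2 * R * q.2)).indicator h (y + q.2 • (q.1 - y)) := by
    have hs : MeasurableSet {q : E × ℝ | dist (y + q.2 • (q.1 - y)) y < 2 * R * q.2} :=
      measurableSet_lt (by fun_prop) (by fun_prop)
    have h2 : Measurable fun q : E × ℝ => h (y + q.2 • (q.1 - y)) :=
      hhm.comp (by fun_prop)
    exact h2.indicator hs
  rw [setLAverage_eq]
  calc (∫⁻ z in B, ‖f z - f y‖ₑ ∂μ) / μ B
      ≤ (∫⁻ z in B, (∫⁻ s in Ioo (0 : ℝ) 1, ENNReal.ofReal (2 * R) *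
        (ball y (2 * R * s)).indicator h (y + s • (z - y))) ∂μ) / μ B := by
        gcongr ?_ / _
        exact setLIntegral_mono' measurableSet_ball hpt
    _ = (∫⁻ s in Ioo (0 : ℝ) 1, ∫⁻ z in B, ENNReal.ofReal (2 * R) *
        (ball y (2 * R * s)).indicator h (y + s • (z - y)) ∂μ) / μ B := by
        rw [lintegral_lintegral_swap (hmeas.const_mul _).aemeasurable]
    _ = ∫⁻ s in Ioo (0 : ℝ) 1, (∫⁻ z in B, ENNReal.ofReal (2 * R) *
        (ball y (2 * R * s)).indicator h (y + s • (z - y)) ∂μ) / μ B := by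
        simp_rw [div_eq_mul_inv]
        rw [lintegral_mul_const' _ _ (ENNReal.inv_ne_top.2 hB0)]
    _ ≤ ∫⁻ s in Ioo (0 : ℝ) 1, 2 ^ d * ENNReal.ofReal (2 * R) *
          ⨍⁻ v in ball y (2 * R * s), h v ∂μ := by
        refine setLIntegral_mono' measurableSet_Ioo fun s hs => ?_
        have hs0 := hs.1
        rw [lintegral_const_mul' _ _ ENNReal.ofReal_ne_top, setLAverage_eq,
          show 2 * R * s = (2 * s) * R by ring,
          Measure.addHaar_ball_mul_of_pos μ y (by positivity), ← hd,
          ← Measure.addHaar_ball_center μ x R, ← hB,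
          ← lintegral_indicator (measurableSet_ball (x := y) (ε := 2 * s * R))]
        set I := ∫⁻ a, (ball y (2 * s * R)).indicator h a ∂μ with hI
        have h1 : ∫⁻ z in B, (ball y (2 * s * R)).indicator h (y + s • (z - y)) ∂μ ≤
            ENNReal.ofReal ((s ^ d)⁻¹) * I := by
          rw [hI, ← lintegral_comp_homothety μ (hhm.indicator measurableSet_ball) y hs0]
          exact setLIntegral_le_lintegral _ _
        have h2 : (2 : ℝ≥0∞) ^ d * (ENNReal.ofReal ((2 * s) ^ d))⁻¹ =
            ENNReal.ofReal ((s ^ d)⁻¹) := by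
          rw [← ENNReal.ofReal_inv_of_pos (by positivity), ← ENNReal.ofReal_ofNat,
            ← ENNReal.ofReal_pow (by norm_num), ← ENNReal.ofReal_mul (by positivity), mul_pow]
          congr 1
          field_simp
        rw [div_eq_mul_inv, div_eq_mul_inv, ENNReal.mul_inv (Or.inr hB1) (Or.inr hB0)]
        calc _ ≤ ENNReal.ofReal (2 * R) * (ENNReal.ofReal ((s ^ d)⁻¹) * I) * (μ B)⁻¹ := by
              gcongr
          _ = _ := by rw [← h2]; ring
    _ = _ := by
        rw [lintegral_const_mul' _ _ (by finiteness)]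

theorem exists_enorm_sub_setAverage_le [Nontrivial E] {α : ℝ} (hα : 1 < α)
    (hαd : α < Module.finrank ℝ E) :
    ∃ C : ℝ≥0∞, C ≠ ∞ ∧ ∀ (f : E → ℝ), Differentiable ℝ f → ∀ (x : E) (R : ℝ), ∀ y ∈ ball x R,
      ‖f y - ⨍ z in ball x R, f z ∂μ‖ₑ ≤
        C * (maximalFunction μ ((ball x R).indicator fun v => ‖fderiv ℝ f v‖ₑ) y ^
          (1 - α / Module.finrank ℝ E) *
          (∫⁻ v in ball x R, ‖fderiv ℝ f v‖ₑ ^ α ∂μ) ^ (1 / (Module.finrank ℝ E : ℝ))) := by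
  set d := Module.finrank ℝ E with hd
  have hα0 : 0 < α := by linarith
  have hd0 : (0 : ℝ) < d := by linarith
  obtain ⟨C, hC, hmin⟩ := exists_lintegral_min_rpow_le (κ := d / α) (by rwa [one_lt_div hα0])
  have hb0 : μ (ball (0 : E) 1) ≠ 0 := (measure_ball_pos μ _ one_pos).ne'
  have hb1 : μ (ball (0 : E) 1) ≠ ∞ := measure_ball_lt_top.ne
  refine ⟨2 ^ d * C * μ (ball (0 : E) 1) ^ (-(1 / (d : ℝ))), ?_, fun f hf x R y hy => ?_⟩
  · refine ENNReal.mul_ne_top (by finiteness) (ENNReal.rpow_ne_top_of_ne_zero hb0 hb1)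
  have hR : 0 < R := pos_of_mem_ball hy
  set h : E → ℝ≥0∞ := (ball x R).indicator (fun v => ‖fderiv ℝ f v‖ₑ) with hh
  have hhm : Measurable h := (measurable_fderiv ℝ f).enorm.indicator measurableSet_ball
  have hI : ∫⁻ v in ball x R, ‖fderiv ℝ f v‖ₑ ^ α ∂μ = ∫⁻ v, h v ^ α ∂μ := by
    rw [← lintegral_indicator measurableSet_ball]
    refine lintegral_congr fun v => ?_
    by_cases hv : v ∈ ball x R
    · rw [hh, indicator_of_mem hv, indicator_of_mem hv]
    · rw [hh, indicator_of_notMem hv, indicator_of_notMem hv, ENNReal.zero_rpow_of_pos hα0]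
  set J := ∫⁻ v, h v ^ α ∂μ with hJ
  rw [hI]
  set V := μ (ball (0 : E) (2 * R)) with hV
  have hV0 : V ≠ 0 := (measure_ball_pos μ _ (by positivity)).ne'
  have hV1 : V ≠ ∞ := measure_ball_lt_top.ne
  have hVd : ENNReal.ofReal (2 * R) * V ^ (-(1 / (d : ℝ))) =
      μ (ball (0 : E) 1) ^ (-(1 / (d : ℝ))) := by
    have h2R : ENNReal.ofReal (2 * R) ≠ 0 := by simpa using hR
    rw [hV, Measure.addHaar_ball_of_pos μ 0 (by positivity), ← hd,
      ENNReal.mul_rpow_of_ne_top (by simp) hb1, ENNReal.ofReal_pow (by positivity),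
      ← ENNReal.rpow_natCast, ← ENNReal.rpow_mul, ← mul_assoc, mul_neg, mul_one_div_cancel hd0.ne',
      ENNReal.rpow_neg_one, ENNReal.mul_inv_cancel h2R ENNReal.ofReal_ne_top, one_mul]
  have h_integ : ∫⁻ s in Ioo (0 : ℝ) 1, ⨍⁻ v in ball y (2 * R * s), h v ∂μ ≤
      C * (maximalFunction μ h y ^ (1 - 1 / (d / α)) *
        (V ^ (-(1 / α)) * J ^ (1 / α)) ^ (1 / (d / α))) := by
    refine le_trans ?_ (hmin _ _)
    refine (setLIntegral_mono' measurableSet_Ioo fun s hs => le_min ?_ ?_).trans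
      (lintegral_mono_set Ioo_subset_Ioi_self)
    · exact laverage_ball_le_maximalFunction μ h
        (mem_ball_self (mul_pos (by positivity) hs.1))
    · have hs0 := hs.1
      refine (laverage_ball_le_rpow μ hhm hα y (by positivity)).trans (le_of_eq ?_)
      rw [mul_comm (2 * R), Measure.addHaar_ball_mul_of_pos μ y hs0, ← hd, ← hV, ← hJ,
        ENNReal.mul_rpow_of_ne_top (by simp) hV1, ENNReal.ofReal_rpow_of_pos (by positivity),
        ← Real.rpow_natCast, ← Real.rpow_mul hs0.le, mul_assoc]
      congr 4
      ring
  refine (enorm_sub_setAverage_le μ hf hy).trans ?_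
  calc _ ≤ 2 ^ d * ENNReal.ofReal (2 * R) * (C * (maximalFunction μ h y ^ (1 - 1 / (d / α)) *
        (V ^ (-(1 / α)) * J ^ (1 / α)) ^ (1 / (d / α)))) := by gcongr
    _ = 2 ^ d * C * (ENNReal.ofReal (2 * R) * V ^ (-(1 / (d : ℝ)))) *
        (maximalFunction μ h y ^ (1 - α / d) * J ^ (1 / (d : ℝ))) := by
      rw [one_div_div, ENNReal.mul_rpow_of_nonneg _ _ (by positivity), ← ENNReal.rpow_mul,
        ← ENNReal.rpow_mul, show -(1 / α) * (α / d) = -(1 / (d : ℝ)) by field_simp,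
        show 1 / α * (α / d) = 1 / (d : ℝ) by field_simp]
      ring
    _ = _ := by rw [hVd]

/-- The Sobolev–Poincaré inequality on balls, at the critical exponent. -/
theorem exists_sobolev_poincare [Nontrivial E] {α : ℝ} (hα : 1 < α)
    (hαd : α < Module.finrank ℝ E) {σ : ℝ} (hσ : 1 / σ = 1 / α - 1 / Module.finrank ℝ E) :
    ∃ C : ℝ≥0∞, C ≠ ∞ ∧ ∀ (f : E → ℝ), Differentiable ℝ f → ∀ (x : E) (R : ℝ),
      (∫⁻ y in ball x R, ‖f y - ⨍ z in ball x R, f z ∂μ‖ₑ ^ σ ∂μ) ^ (1 / σ) ≤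
        C * (∫⁻ v in ball x R, ‖fderiv ℝ f v‖ₑ ^ α ∂μ) ^ (1 / α) := by
  have hα0 : 0 < α := by linarith
  have hd0 : (0 : ℝ) < Module.finrank ℝ E := by linarith
  have hσ0 : 0 < σ := by
    rw [← one_div_pos, hσ, sub_pos]
    exact one_div_lt_one_div_of_lt hα0 hαd
  obtain ⟨C, hC, hpt⟩ := exists_enorm_sub_setAverage_le μ hα hαd
  obtain ⟨K, hK, hmax⟩ := exists_lintegral_maximalFunction_rpow_le μ hα
  refine ⟨C * K ^ (1 / σ), ENNReal.mul_ne_top hC (ENNReal.rpow_ne_top_of_nonneg (by positivity) hK),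
    fun f hf x R => ?_⟩
  set d := (Module.finrank ℝ E : ℝ) with hd
  set h : E → ℝ≥0∞ := (ball x R).indicator (fun v => ‖fderiv ℝ f v‖ₑ) with hh
  have hhm : Measurable h := (measurable_fderiv ℝ f).enorm.indicator measurableSet_ball
  have hI : ∫⁻ v in ball x R, ‖fderiv ℝ f v‖ₑ ^ α ∂μ = ∫⁻ v, h v ^ α ∂μ := by
    rw [← lintegral_indicator measurableSet_ball]
    refine lintegral_congr fun v => ?_
    by_cases hv : v ∈ ball x R
    · rw [hh, indicator_of_mem hv, indicator_of_mem hv]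
    · rw [hh, indicator_of_notMem hv, indicator_of_notMem hv, ENNReal.zero_rpow_of_pos hα0]
  set J := ∫⁻ v in ball x R, ‖fderiv ℝ f v‖ₑ ^ α ∂μ with hJ
  have he : (1 - α / d) * σ = α := by
    have : 1 - α / d = α * (1 / σ) := by rw [hσ]; field_simp
    rw [this]; field_simp
  calc _ ≤ (∫⁻ y in ball x R, (C * J ^ (1 / d)) ^ σ * maximalFunction μ h y ^ α ∂μ) ^ (1 / σ) := by
        refine ENNReal.rpow_le_rpow ?_ (by positivity)
        refine setLIntegral_mono' measurableSet_ball fun y hy => ?_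
        refine (ENNReal.rpow_le_rpow (hpt f hf x R y hy) hσ0.le).trans (le_of_eq ?_)
        rw [← mul_assoc, mul_right_comm, ENNReal.mul_rpow_of_nonneg _ _ hσ0.le,
          ← ENNReal.rpow_mul (maximalFunction μ h y), he]
    _ ≤ ((C * J ^ (1 / d)) ^ σ * (K * J)) ^ (1 / σ) := by
        refine ENNReal.rpow_le_rpow ?_ (by positivity)
        rw [lintegral_const_mul _ ((measurable_maximalFunction μ h).pow_const α)]
        gcongr
        rw [hI]
        exact (setLIntegral_le_lintegral _ _).trans (hmax h hhm)
    _ = C * K ^ (1 / σ) * (J ^ (1 / d) * J ^ (1 / σ)) := by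
        rw [ENNReal.mul_rpow_of_nonneg _ _ (by positivity), ← ENNReal.rpow_mul,
          mul_one_div_cancel hσ0.ne', ENNReal.rpow_one,
          ENNReal.mul_rpow_of_nonneg _ _ (by positivity)]
        ring
    _ = _ := by
        rw [← ENNReal.rpow_add_of_nonneg _ _ (by positivity) (by positivity), hσ]
        congr 2
        ring

end Poincare

section Dyadic

variable {E : Type*} [NormedAddCommGroup E]

theorem iUnion_dyadic_annuli {a : ℝ} (ha : 0 < a) (m : ℕ) :
    ⋃ k : ℕ, {y : E | a * 2 ^ ((k : ℤ) - m) < ‖y‖ ∧ ‖y‖ ≤ 2 * (a * 2 ^ ((k : ℤ) - m))} =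
      {y | a * 2 ^ (-(m : ℤ)) < ‖y‖} := by
  ext y
  simp only [mem_iUnion, mem_ofPred_eq]
  constructor
  · rintro ⟨k, hk, -⟩
    refine lt_of_le_of_lt ?_ hk
    gcongr
    · norm_num
    · omega
  · intro hy
    have hy0 : 0 < ‖y‖ / a := div_pos (lt_trans (by positivity) hy) ha
    obtain ⟨j, hj1, hj2⟩ := exists_mem_Ioc_zpow hy0 (one_lt_two : (1 : ℝ) < 2)
    rw [lt_div_iff₀ ha] at hj1
    rw [div_le_iff₀ ha, zpow_add_one₀ (by norm_num)] at hj2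
    have hj : -(m : ℤ) < j + 1 := by
      rw [← zpow_lt_zpow_iff_right₀ (one_lt_two : (1 : ℝ) < 2), zpow_add_one₀ (by norm_num)]
      nlinarith
    obtain ⟨k, hk⟩ := Int.eq_ofNat_of_zero_le (show 0 ≤ j + m by omega)
    refine ⟨k, ?_⟩
    rw [show (k : ℤ) - m = j by omega]
    constructor <;> linarith

theorem pairwise_disjoint_dyadic_annuli {a : ℝ} (ha : 0 < a) (m : ℕ) :
    Pairwise (Function.onFun Disjoint fun k : ℕ =>
      {y : E | a * 2 ^ ((k : ℤ) - m) < ‖y‖ ∧ ‖y‖ ≤ 2 * (a * 2 ^ ((k : ℤ) - m))}) := by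
  refine (pairwise_disjoint_on _).2 fun i j hij => ?_
  rw [Set.disjoint_left]
  rintro y ⟨-, hi⟩ ⟨hj, -⟩
  have : 2 * (a * (2 : ℝ) ^ ((i : ℤ) - m)) ≤ a * 2 ^ ((j : ℤ) - m) := by
    calc 2 * (a * (2 : ℝ) ^ ((i : ℤ) - m)) = a * 2 ^ ((i : ℤ) - m + 1) := by
          rw [zpow_add_one₀ (by norm_num)]; ring
      _ ≤ _ := by
          gcongr
          · norm_num
          · omega
  linarith

end Dyadic

section Homogeneous

variable {E : Type*} [NormedAddCommGroup E] [NormedSpace ℝ E] [MeasurableSpace E] [BorelSpace E]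
  [FiniteDimensional ℝ E] [Nontrivial E] (μ : Measure E) [μ.IsAddHaarMeasure]

theorem lintegral_norm_mul_homogeneous {φ : ℝ → ℝ≥0∞} (hφ : Measurable φ) {G : E → ℝ≥0∞}
    (hG : Measurable G) (hhom : ∀ c : ℝ, 0 < c → ∀ y, G (c • y) = G y) :
    ∫⁻ y, G y * φ ‖y‖ ∂μ = (∫⁻ z, G z ∂μ.toSphere) *
      ∫⁻ r, φ r ∂(Measure.volumeIoiPow (Module.finrank ℝ E - 1)) := by
  have hms : MeasurableSet ({0}ᶜ : Set E) := (measurableSet_singleton _).compl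
  calc ∫⁻ y, G y * φ ‖y‖ ∂μ = ∫⁻ y : ({0}ᶜ : Set E), G y * φ ‖(y : E)‖ ∂(μ.comap (↑)) := by
        rw [lintegral_subtype_comap hms (fun y => G y * φ ‖y‖), restrict_compl_singleton]
    _ = ∫⁻ y : ({0}ᶜ : Set E), (fun w : sphere (0 : E) 1 × Ioi (0 : ℝ) => G w.1 * φ w.2)
          (homeomorphUnitSphereProd E y) ∂(μ.comap (↑)) := by
        refine lintegral_congr fun y => ?_
        have hy : 0 < ‖(y : E)‖ := norm_pos_iff.2 y.2
        simp [homeomorphUnitSphereProd, hhom _ (inv_pos.2 hy)]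
    _ = ∫⁻ w, G w.1 * φ w.2
          ∂(μ.toSphere.prod (Measure.volumeIoiPow (Module.finrank ℝ E - 1))) :=
        μ.measurePreserving_homeomorphUnitSphereProd.lintegral_comp_emb
          (Homeomorph.measurableEmbedding _)
          (fun w : sphere (0 : E) 1 × Ioi (0 : ℝ) => G w.1 * φ w.2)
    _ = _ := lintegral_prod_mul (f := fun z : sphere (0 : E) 1 => G z)
        (g := fun r : Ioi (0 : ℝ) => φ r) (by fun_prop) (by fun_prop)

theorem integral_norm_mul_homogeneous (φ : ℝ → ℝ) {G : E → ℝ}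
    (hhom : ∀ c : ℝ, 0 < c → ∀ y, G (c • y) = G y) :
    ∫ y, G y * φ ‖y‖ ∂μ = (∫ z, G z ∂μ.toSphere) *
      ∫ r, φ r ∂(Measure.volumeIoiPow (Module.finrank ℝ E - 1)) := by
  have hms : MeasurableSet ({0}ᶜ : Set E) := (measurableSet_singleton _).compl
  calc ∫ y, G y * φ ‖y‖ ∂μ = ∫ y : ({0}ᶜ : Set E), G y * φ ‖(y : E)‖ ∂(μ.comap (↑)) := by
        rw [integral_subtype_comap hms (fun y => G y * φ ‖y‖), restrict_compl_singleton]
    _ = ∫ y : ({0}ᶜ : Set E), (fun w : sphere (0 : E) 1 × Ioi (0 : ℝ) => G w.1 * φ w.2)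
          (homeomorphUnitSphereProd E y) ∂(μ.comap (↑)) := by
        refine integral_congr_ae (Eventually.of_forall fun y => ?_)
        have hy : 0 < ‖(y : E)‖ := norm_pos_iff.2 y.2
        simp [homeomorphUnitSphereProd, hhom _ (inv_pos.2 hy)]
    _ = ∫ w, G w.1 * φ w.2
          ∂(μ.toSphere.prod (Measure.volumeIoiPow (Module.finrank ℝ E - 1))) :=
        μ.measurePreserving_homeomorphUnitSphereProd.integral_comp
          (Homeomorph.measurableEmbedding _)
          (fun w : sphere (0 : E) 1 × Ioi (0 : ℝ) => G w.1 * φ w.2)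
    _ = _ := integral_prod_mul (fun z : sphere (0 : E) 1 => G z) (fun r : Ioi (0 : ℝ) => φ r)

theorem setLIntegral_ball_homogeneous_le {G : E → ℝ≥0∞} (hG : Measurable G)
    (hhom : ∀ c : ℝ, 0 < c → ∀ y, G (c • y) = G y) {R : ℝ} (hR : 0 < R) :
    ∫⁻ y in ball 0 R, G y ∂μ ≤
      (∫⁻ z, G z ∂μ.toSphere) * ENNReal.ofReal (R ^ Module.finrank ℝ E) := by
  have hd : 0 < Module.finrank ℝ E := Module.finrank_pos
  calc ∫⁻ y in ball 0 R, G y ∂μ = ∫⁻ y, G y * (Iio R).indicator 1 ‖y‖ ∂μ := by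
        rw [← lintegral_indicator measurableSet_ball]
        refine lintegral_congr fun y => ?_
        by_cases hy : ‖y‖ < R <;> simp [hy, indicator]
    _ = (∫⁻ z, G z ∂μ.toSphere) * Measure.volumeIoiPow (Module.finrank ℝ E - 1)
          (Iio (⟨R, hR⟩ : Ioi (0 : ℝ))) := by
        rw [lintegral_norm_mul_homogeneous μ (measurable_one.indicator measurableSet_Iio) hG hhom,
          ← lintegral_indicator_one measurableSet_Iio]
        rfl
    _ ≤ _ := by
        rw [Measure.volumeIoiPow_apply_Iio, Nat.sub_add_cancel hd]
        gcongr
        exact div_le_self (by positivity) (by simp)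

theorem exists_enorm_setIntegral_annulus_le {α : ℝ} (hα : 1 < α)
    (hαd : α < Module.finrank ℝ E) {σ τ : ℝ} (hσ : 1 / σ = 1 / α - 1 / Module.finrank ℝ E)
    (hτ : τ.HolderConjugate σ) :
    ∃ C : ℝ≥0∞, C ≠ ∞ ∧ ∀ (Ω : E → ℝ), Measurable Ω →
      (∀ c : ℝ, 0 < c → ∀ y, Ω (c • y) = Ω y) →
      Integrable (fun z : sphere (0 : E) 1 => Ω z) μ.toSphere →
      ∫ z : sphere (0 : E) 1, Ω z ∂μ.toSphere = 0 →
      ∀ (f : E → ℝ), Differentiable ℝ f → ∀ (x : E) (a : ℝ), 0 < a →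
      IntegrableOn (fun y => Ω y / ‖y‖ ^ Module.finrank ℝ E * f (x - y))
        {y | a < ‖y‖ ∧ ‖y‖ ≤ 2 * a} μ →
      ‖∫ y in {y | a < ‖y‖ ∧ ‖y‖ ≤ 2 * a},
          Ω y / ‖y‖ ^ Module.finrank ℝ E * f (x - y) ∂μ‖ₑ ≤
        C * (∫⁻ z : sphere (0 : E) 1, ‖Ω z‖ₑ ^ τ ∂μ.toSphere) ^ (1 / τ) *
          (ENNReal.ofReal ((3 * a) ^ (1 - Module.finrank ℝ E / α)) *
            (∫⁻ v in ball x (3 * a), ‖fderiv ℝ f v‖ₑ ^ α ∂μ) ^ (1 / α)) := by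
  obtain ⟨C, hC, hSP⟩ := exists_sobolev_poincare μ hα hαd hσ
  set d := Module.finrank ℝ E with hd
  have hd0 : (0 : ℝ) < d := by linarith
  refine ⟨3 ^ d * C, by finiteness, fun Ω hΩ hhom hΩi hΩ0 f hf x a ha h_integ => ?_⟩
  set A : Set E := {y | a < ‖y‖ ∧ ‖y‖ ≤ 2 * a} with hA
  have hAm : MeasurableSet A :=
    (measurableSet_lt measurable_const measurable_norm).inter
      (measurableSet_le measurable_norm measurable_const)
  have hAB : A ⊆ ball 0 (3 * a) := fun y hy => by
    rw [mem_ball_zero_iff]; linarith [hy.2]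
  set c := ⨍ z in ball x (3 * a), f z ∂μ with hc
  have hkm : Measurable fun y : E => Ω y / ‖y‖ ^ d := by fun_prop
  have hkle : ∀ y ∈ A, ‖Ω y / ‖y‖ ^ d‖ₑ ≤ ENNReal.ofReal ((a ^ d)⁻¹) * ‖Ω y‖ₑ := by
    intro y hy
    rw [div_eq_inv_mul, enorm_mul]
    gcongr
    rw [Real.enorm_eq_ofReal (by positivity)]
    refine ENNReal.ofReal_le_ofReal ?_
    gcongr
    exact hy.1.le
  have hki : IntegrableOn (fun y => Ω y / ‖y‖ ^ d) A μ := by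
    refine ⟨hkm.aestronglyMeasurable, ?_⟩
    calc ∫⁻ y in A, ‖Ω y / ‖y‖ ^ d‖ₑ ∂μ
        ≤ ∫⁻ y in A, ENNReal.ofReal ((a ^ d)⁻¹) * ‖Ω y‖ₑ ∂μ := setLIntegral_mono' hAm hkle
      _ ≤ ∫⁻ y in ball 0 (3 * a), ENNReal.ofReal ((a ^ d)⁻¹) * ‖Ω y‖ₑ ∂μ :=
          lintegral_mono_set hAB
      _ = ENNReal.ofReal ((a ^ d)⁻¹) * ∫⁻ y in ball 0 (3 * a), ‖Ω y‖ₑ ∂μ :=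
          lintegral_const_mul _ hΩ.enorm
      _ ≤ ENNReal.ofReal ((a ^ d)⁻¹) * ((∫⁻ z : sphere (0 : E) 1, ‖Ω z‖ₑ ∂μ.toSphere) *
            ENNReal.ofReal ((3 * a) ^ d)) := by
          gcongr
          exact setLIntegral_ball_homogeneous_le μ hΩ.enorm
            (fun c hc y => by rw [hhom c hc]) (by positivity)
      _ < ∞ := by
          have : ∫⁻ z : sphere (0 : E) 1, ‖Ω z‖ₑ ∂μ.toSphere < ∞ := hΩi.2
          finiteness
  have hk0 : ∫ y in A, Ω y / ‖y‖ ^ d ∂μ = 0 := by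
    rw [← integral_indicator hAm]
    calc _ = ∫ y, Ω y * (Ioc a (2 * a)).indicator (fun r => (r ^ d)⁻¹) ‖y‖ ∂μ := by
          refine integral_congr_ae (Eventually.of_forall fun y => ?_)
          by_cases hy : y ∈ A
          · have hy' : ‖y‖ ∈ Ioc a (2 * a) := hy
            simp only [indicator_of_mem hy, indicator_of_mem hy', div_eq_mul_inv]
          · have hy' : ‖y‖ ∉ Ioc a (2 * a) := hy
            simp only [indicator_of_notMem hy, indicator_of_notMem hy', mul_zero]
      _ = 0 := by rw [integral_norm_mul_homogeneous μ _ hhom, hΩ0, zero_mul]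
  have heq : ∫ y in A, Ω y / ‖y‖ ^ d * f (x - y) ∂μ =
      ∫ y in A, Ω y / ‖y‖ ^ d * (f (x - y) - c) ∂μ := by
    simp_rw [mul_sub]
    rw [integral_sub h_integ (hki.mul_const c), integral_mul_const, hk0, zero_mul, sub_zero]
  have hfm : Measurable f := hf.continuous.measurable
  have htrans : ∫⁻ y in A, ‖f (x - y) - c‖ₑ ^ σ ∂μ ≤
      ∫⁻ v in ball x (3 * a), ‖f v - c‖ₑ ^ σ ∂μ := by
    calc ∫⁻ y in A, ‖f (x - y) - c‖ₑ ^ σ ∂μ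
        = ∫⁻ y, A.indicator (fun y => ‖f (x - y) - c‖ₑ ^ σ) y ∂μ :=
          (lintegral_indicator hAm _).symm
      _ ≤ ∫⁻ y, (ball x (3 * a)).indicator (fun v => ‖f v - c‖ₑ ^ σ) (x - y) ∂μ := by
          refine lintegral_mono fun y => ?_
          by_cases hy : y ∈ A
          · have : x - y ∈ ball x (3 * a) := by simpa using hAB hy
            simp only [indicator_of_mem hy, indicator_of_mem this, le_refl]
          · simp only [indicator_of_notMem hy, zero_le]
      _ = ∫⁻ v, (ball x (3 * a)).indicator (fun v => ‖f v - c‖ₑ ^ σ) v ∂μ :=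
          lintegral_sub_left_eq_self _ x
      _ = _ := lintegral_indicator measurableSet_ball _
  have hΩτ : ∫⁻ y in A, ‖Ω y‖ₑ ^ τ ∂μ ≤
      (∫⁻ z : sphere (0 : E) 1, ‖Ω z‖ₑ ^ τ ∂μ.toSphere) * ENNReal.ofReal ((3 * a) ^ d) :=
    (lintegral_mono_set hAB).trans (setLIntegral_ball_homogeneous_le μ
      (hΩ.enorm.pow_const τ) (fun c hc y => by rw [hhom c hc]) (by positivity))
  set W := ∫⁻ z : sphere (0 : E) 1, ‖Ω z‖ₑ ^ τ ∂μ.toSphere with hW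
  set J := ∫⁻ v in ball x (3 * a), ‖fderiv ℝ f v‖ₑ ^ α ∂μ with hJ
  have hτ0 : 0 < τ := hτ.pos
  have hpow : ENNReal.ofReal ((a ^ d)⁻¹) * ENNReal.ofReal ((3 * a) ^ d) ^ (1 / τ) =
      3 ^ d * ENNReal.ofReal ((3 * a) ^ (1 - d / α)) := by
    have h3a : 0 < 3 * a := by positivity
    have he : (1 - d / α : ℝ) = d * (1 / τ) - d := by
      have h1 := hτ.inv_add_inv_eq_one
      have h2 : 1 / τ = 1 - 1 / σ := by simp only [one_div]; linarith
      have h3 : d * (1 / τ) - d = -(d * (1 / σ)) := by rw [h2]; ring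
      rw [h3, hσ]
      field_simp
      ring
    rw [ENNReal.ofReal_rpow_of_pos (by positivity), ← ENNReal.ofReal_mul (by positivity),
      ← ENNReal.ofReal_ofNat, ← ENNReal.ofReal_pow (by norm_num),
      ← ENNReal.ofReal_mul (by positivity), he, Real.rpow_sub h3a, Real.rpow_mul h3a.le,
      Real.rpow_natCast, mul_pow]
    congr 1
    field_simp
  rw [heq]
  calc _ ≤ ∫⁻ y in A, ‖Ω y / ‖y‖ ^ d * (f (x - y) - c)‖ₑ ∂μ :=
        enorm_integral_le_lintegral_enorm _
    _ ≤ ∫⁻ y in A, ENNReal.ofReal ((a ^ d)⁻¹) * (‖Ω y‖ₑ * ‖f (x - y) - c‖ₑ) ∂μ := by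
        refine setLIntegral_mono' hAm fun y hy => ?_
        rw [enorm_mul, ← mul_assoc]
        gcongr
        exact hkle y hy
    _ = ENNReal.ofReal ((a ^ d)⁻¹) * ∫⁻ y in A, ‖Ω y‖ₑ * ‖f (x - y) - c‖ₑ ∂μ :=
        lintegral_const_mul' _ _ ENNReal.ofReal_ne_top
    _ ≤ ENNReal.ofReal ((a ^ d)⁻¹) * ((∫⁻ y in A, ‖Ω y‖ₑ ^ τ ∂μ) ^ (1 / τ) *
          (∫⁻ y in A, ‖f (x - y) - c‖ₑ ^ σ ∂μ) ^ (1 / σ)) := by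
        gcongr
        exact ENNReal.lintegral_mul_le_Lp_mul_Lq (μ.restrict A) hτ hΩ.enorm.aemeasurable
          (by fun_prop)
    _ ≤ ENNReal.ofReal ((a ^ d)⁻¹) * ((W * ENNReal.ofReal ((3 * a) ^ d)) ^ (1 / τ) *
          (C * J ^ (1 / α))) := by
        have hσ0 : 0 ≤ 1 / σ := hτ.symm.one_div_nonneg
        gcongr
        exact (ENNReal.rpow_le_rpow htrans hσ0).trans (hSP f hf x (3 * a))
    _ = (ENNReal.ofReal ((a ^ d)⁻¹) * ENNReal.ofReal ((3 * a) ^ d) ^ (1 / τ)) * C *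
          W ^ (1 / τ) * J ^ (1 / α) := by
        rw [ENNReal.mul_rpow_of_nonneg _ _ (by positivity)]
        ring
    _ = _ := by
        rw [hpow]
        ring

/-- Pointwise bound for a principal value singular integral with mean-zero homogeneous kernel. -/
theorem exists_enorm_singularIntegral_le {α β : ℝ} (hα : 1 < α) (hαβ : α < β)
    (hαd : α < Module.finrank ℝ E) {σ τ : ℝ} (hσ : 1 / σ = 1 / α - 1 / Module.finrank ℝ E)
    (hτ : τ.HolderConjugate σ) :
    ∃ C : ℝ≥0∞, C ≠ ∞ ∧ ∀ (Ω : E → ℝ), Measurable Ω →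
      (∀ c : ℝ, 0 < c → ∀ y, Ω (c • y) = Ω y) →
      Integrable (fun z : sphere (0 : E) 1 => Ω z) μ.toSphere →
      ∫ z : sphere (0 : E) 1, Ω z ∂μ.toSphere = 0 →
      ∀ (f : E → ℝ), Differentiable ℝ f → ∀ (x : E) (N : ℝ≥0∞),
      (∀ r : ℝ, 0 < r → (ENNReal.ofReal (r ^ (β - Module.finrank ℝ E)) *
        ∫⁻ v in ball x r, ‖fderiv ℝ f v‖ₑ ^ α ∂μ) ^ (1 / α) ≤ N) →
      ∀ g : ℝ, Tendsto (fun t : ℝ => ∫ y in {y | t < ‖y‖},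
          Ω y / ‖y‖ ^ Module.finrank ℝ E * f (x - y) ∂μ) (nhdsWithin 0 (Ioi 0)) (nhds g) →
      ‖g‖ₑ ≤ C * (∫⁻ z : sphere (0 : E) 1, ‖Ω z‖ₑ ^ τ ∂μ.toSphere) ^ (1 / τ) *
        (maximalFunction μ (fun v => ‖fderiv ℝ f v‖ₑ ^ α) x ^ (1 / α * (1 - α / β)) *
          N ^ (α / β)) := by
  have hα0 : 0 < α := by linarith
  have hβ0 : 0 < β := by linarith
  obtain ⟨C, hC, hann⟩ := exists_enorm_setIntegral_annulus_le μ hα hαd hσ hτ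
  obtain ⟨S, hS, hsum⟩ := exists_tsum_min_two_zpow_le (b := β / α) (by rwa [one_lt_div hα0])
  set d := Module.finrank ℝ E with hd
  set κ := μ (ball (0 : E) 1) with hκ
  have hκ1 : κ ≠ ∞ := measure_ball_lt_top.ne
  have hθ : 0 ≤ 1 / α * (1 - α / β) := by
    have : α / β ≤ 1 := (div_le_one hβ0).2 hαβ.le
    exact mul_nonneg (by positivity) (by linarith)
  refine ⟨C * S * κ ^ (1 / α * (1 - α / β)),
    ENNReal.mul_ne_top (by finiteness) (ENNReal.rpow_ne_top_of_nonneg hθ hκ1),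
    fun Ω hΩ hhom hΩi hΩ0 f hf x N hN g hg => ?_⟩
  set M := maximalFunction μ (fun v => ‖fderiv ℝ f v‖ₑ ^ α) x with hM
  set W := (∫⁻ z : sphere (0 : E) 1, ‖Ω z‖ₑ ^ τ ∂μ.toSphere) ^ (1 / τ) with hW
  have hD : ∀ R : ℝ, 0 < R → ENNReal.ofReal (R ^ (1 - d / α)) *
      (∫⁻ v in ball x R, ‖fderiv ℝ f v‖ₑ ^ α ∂μ) ^ (1 / α) ≤
      min (ENNReal.ofReal R * (κ * M) ^ (1 / α)) (ENNReal.ofReal (R ^ (1 - β / α)) * N) := by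
    intro R hR
    refine le_min ?_ ?_
    · have h1 : ∫⁻ v in ball x R, ‖fderiv ℝ f v‖ₑ ^ α ∂μ ≤ ENNReal.ofReal (R ^ d) * (κ * M) := by
        have := laverage_ball_le_maximalFunction μ (fun v => ‖fderiv ℝ f v‖ₑ ^ α)
          (mem_ball_self hR : x ∈ ball x R)
        rw [setLAverage_eq, ENNReal.div_le_iff (measure_ball_pos μ _ hR).ne'
          measure_ball_lt_top.ne, Measure.addHaar_ball_of_pos μ x hR] at this
        refine this.trans (le_of_eq ?_)
        rw [← hκ, ← hM, ← hd]
        ring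
      calc _ ≤ ENNReal.ofReal (R ^ (1 - d / α)) *
            (ENNReal.ofReal (R ^ d) * (κ * M)) ^ (1 / α) := by gcongr
        _ = _ := by
          rw [ENNReal.mul_rpow_of_nonneg _ _ (by positivity),
            ENNReal.ofReal_rpow_of_pos (by positivity), ← mul_assoc,
            ← ENNReal.ofReal_mul (by positivity), ← Real.rpow_natCast, ← Real.rpow_mul hR.le,
            ← Real.rpow_add hR, show (1 - d / α + d * (1 / α) : ℝ) = 1 by ring, Real.rpow_one]
    · calc _ = ENNReal.ofReal (R ^ (1 - β / α)) * (ENNReal.ofReal (R ^ (β - d)) *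
            ∫⁻ v in ball x R, ‖fderiv ℝ f v‖ₑ ^ α ∂μ) ^ (1 / α) := by
              rw [ENNReal.mul_rpow_of_nonneg _ _ (by positivity),
                ENNReal.ofReal_rpow_of_pos (by positivity), ← mul_assoc,
                ← ENNReal.ofReal_mul (by positivity), ← Real.rpow_mul hR.le, ← Real.rpow_add hR]
              congr 3
              ring_nf
        _ ≤ _ := by
          gcongr
          exact hN R hR
  obtain ⟨l, hl, hlsum⟩ := hsum ((κ * M) ^ (1 / α)) N
  set a := l / 3 with ha
  have ha0 : 0 < a := by positivity
  have hbound : ∀ m : ℕ, ‖∫ y in {y | a * 2 ^ (-(m : ℤ)) < ‖y‖},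
      Ω y / ‖y‖ ^ d * f (x - y) ∂μ‖ₑ ≤
      C * W * (S * (((κ * M) ^ (1 / α)) ^ (1 - 1 / (β / α)) * N ^ (1 / (β / α)))) := by
    intro m
    by_cases hi : IntegrableOn (fun y => Ω y / ‖y‖ ^ d * f (x - y))
      {y | a * 2 ^ (-(m : ℤ)) < ‖y‖} μ
    swap
    · rw [integral_undef hi]; simp
    rw [← iUnion_dyadic_annuli ha0 m] at hi ⊢
    have hmeas : ∀ k : ℕ, MeasurableSet
        {y : E | a * 2 ^ ((k : ℤ) - m) < ‖y‖ ∧ ‖y‖ ≤ 2 * (a * 2 ^ ((k : ℤ) - m))} := fun k =>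
      (measurableSet_lt measurable_const measurable_norm).inter
        (measurableSet_le measurable_norm measurable_const)
    rw [integral_iUnion hmeas (pairwise_disjoint_dyadic_annuli ha0 m) hi]
    have hterm : ∀ k : ℕ, ‖∫ y in
        {y : E | a * 2 ^ ((k : ℤ) - m) < ‖y‖ ∧ ‖y‖ ≤ 2 * (a * 2 ^ ((k : ℤ) - m))},
        Ω y / ‖y‖ ^ d * f (x - y) ∂μ‖ₑ ≤ C * W *
        min (ENNReal.ofReal (l * 2 ^ ((k : ℤ) - m)) * (κ * M) ^ (1 / α))
          (ENNReal.ofReal ((l * 2 ^ ((k : ℤ) - m)) ^ (1 - β / α)) * N) := by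
      intro k
      refine (hann Ω hΩ hhom hΩi hΩ0 f hf x (a * 2 ^ ((k : ℤ) - m)) (by positivity)
        (hi.mono_set (subset_iUnion_of_subset k subset_rfl))).trans ?_
      rw [show 3 * (a * (2 : ℝ) ^ ((k : ℤ) - m)) = l * 2 ^ ((k : ℤ) - m) by rw [ha]; ring]
      gcongr
      exact hD _ (by positivity)
    refine (enorm_tsum_le_tsum_enorm).trans ((ENNReal.tsum_le_tsum hterm).trans ?_)
    rw [ENNReal.tsum_mul_left]
    gcongr
    refine le_trans ?_ hlsum
    exact ENNReal.tsum_comp_le_tsum_of_injective (f := fun k : ℕ => (k : ℤ) - m)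
      (fun i j hij => by simpa using hij) (fun j : ℤ =>
        min (ENNReal.ofReal (l * 2 ^ j) * (κ * M) ^ (1 / α))
          (ENNReal.ofReal ((l * 2 ^ j) ^ (1 - β / α)) * N))
  have hlim : Tendsto (fun m : ℕ => a * (2 : ℝ) ^ (-(m : ℤ))) atTop (nhdsWithin 0 (Ioi 0)) := by
    refine tendsto_nhdsWithin_iff.2 ⟨?_, Eventually.of_forall fun m => by
      simp only [mem_Ioi]; positivity⟩
    have := (tendsto_pow_atTop_nhds_zero_of_lt_one (r := (1 / 2 : ℝ)) (by norm_num)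
      (by norm_num)).const_mul a
    rw [mul_zero] at this
    refine this.congr fun m => ?_
    simp
  refine (le_of_tendsto ((hg.comp hlim).enorm) (Eventually.of_forall hbound)).trans (le_of_eq ?_)
  rw [one_div_div, ← ENNReal.rpow_mul, ENNReal.mul_rpow_of_nonneg _ _ hθ]
  ring

end Homogeneous

theorem lintegral_enorm_rpow_le_of_measure_univ {X : Type*} [MeasurableSpace X] (ν : Measure X)
    {τ ρ : ℝ} (hτ : 0 < τ) (hτρ : τ ≤ ρ) {Ω : X → ℝ} (hΩ : Measurable Ω) :
    (∫⁻ z, ‖Ω z‖ₑ ^ τ ∂ν) ^ (1 / τ) ≤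
      (∫⁻ z, ‖Ω z‖ₑ ^ ρ ∂ν) ^ (1 / ρ) * ν univ ^ (1 / τ - 1 / ρ) :=
  eLpNorm'_le_eLpNorm'_mul_rpow_measure_univ hτ hτρ hΩ.aestronglyMeasurable

theorem rpow_lintegral_rpow_le_of_le_maximalFunction {E : Type*} [NormedAddCommGroup E]
    [NormedSpace ℝ E] [MeasurableSpace E] [BorelSpace E] [FiniteDimensional ℝ E]
    [Nontrivial E] (μ : Measure E) [μ.IsAddHaarMeasure] {α θ p q : ℝ} (hα : 0 < α)
    (hαp : α < p) (hq : 0 < q) (hθ : p = q * θ) :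
    ∃ K : ℝ≥0∞, K ≠ ∞ ∧ ∀ D : E → ℝ≥0∞, Measurable D → ∀ (G : E → ℝ≥0∞) (A : ℝ≥0∞),
      (∀ x, G x ≤ A * maximalFunction μ (fun v => D v ^ α) x ^ (1 / α * θ)) →
      (∫⁻ x, G x ^ q ∂μ) ^ (1 / q) ≤ K * A * ((∫⁻ x, D x ^ p ∂μ) ^ (1 / p)) ^ θ := by
  have hp : 0 < p := hα.trans hαp
  obtain ⟨K, hK, hmax⟩ := exists_lintegral_maximalFunction_rpow_le μ ((one_lt_div hα).2 hαp)
  have hq' : 0 ≤ 1 / q := by positivity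
  refine ⟨K ^ (1 / q), ENNReal.rpow_ne_top_of_nonneg hq' hK, fun D hD G A hG => ?_⟩
  have hDm : Measurable fun v => D v ^ α := hD.pow_const α
  have hle : ∫⁻ x, G x ^ q ∂μ ≤ A ^ q * (K * ∫⁻ x, D x ^ p ∂μ) := by
    calc ∫⁻ x, G x ^ q ∂μ
        ≤ ∫⁻ x, A ^ q * maximalFunction μ (fun v => D v ^ α) x ^ (p / α) ∂μ := by
          refine lintegral_mono fun x => (ENNReal.rpow_le_rpow (hG x) hq.le).trans (le_of_eq ?_)
          rw [ENNReal.mul_rpow_of_nonneg _ _ hq.le, ← ENNReal.rpow_mul, hθ]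
          congr 2
          ring
      _ = A ^ q * ∫⁻ x, maximalFunction μ (fun v => D v ^ α) x ^ (p / α) ∂μ :=
          lintegral_const_mul _ ((measurable_maximalFunction μ _).pow_const _)
      _ ≤ A ^ q * (K * ∫⁻ x, (D x ^ α) ^ (p / α) ∂μ) := by
          gcongr
          exact hmax _ hDm
      _ = _ := by
          simp_rw [← ENNReal.rpow_mul, mul_div_cancel₀ p hα.ne']
  refine (ENNReal.rpow_le_rpow hle hq').trans (le_of_eq ?_)
  rw [ENNReal.mul_rpow_of_nonneg _ _ hq', ENNReal.mul_rpow_of_nonneg _ _ hq',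
    ← ENNReal.rpow_mul, ← ENNReal.rpow_mul, mul_one_div_cancel hq.ne', ENNReal.rpow_one,
    show 1 / p * θ = 1 / q by rw [hθ] at hp ⊢; have := right_ne_zero_of_mul hp.ne'; field_simp]
  ring

/-- refined Sobolev inequality: with `Ω ∈ L^ρ(𝕊^{n-1})` mean zero
(`1 < ρ < n`), `ρn/(ρn+ρ-n) ≤ α`, `1 < α < β < n`, if `∇f ∈ Ṁ^{α,αn/β}` and `∇f ∈ L^p`
(`α < p < ∞`), and `q = p/(1-α/β)`, then
`‖T_Ω f‖_{L^q} ≤ C ‖Ω‖_{L^ρ(𝕊^{n-1})} ‖∇f‖_{Ṁ^{α,αn/β}}^{α/β} ‖∇f‖_{L^p}^{1-α/β}`. -/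
theorem refined_sobolev (n : ℕ) (hn : 2 ≤ n) (ρ α β p q : ℝ) (hρ : 1 < ρ) (hρn : ρ < n)
    (hα₁ : ρ * n / (ρ * n + ρ - n) ≤ α) (hα : 1 < α) (hαβ : α < β) (hβ : β < n)
    (hαp : α < p) (hq : q = p / (1 - α / β)) :
    ∃ C : ℝ, 0 < C ∧
      ∀ (Ω : EuclideanSpace ℝ (Fin n) → ℝ), Measurable Ω →
        (∀ c : ℝ, 0 < c → ∀ y, Ω (c • y) = Ω y) →
        Integrable (fun z : sphere (0 : EuclideanSpace ℝ (Fin n)) 1 => Ω (z : EuclideanSpace ℝ (Fin n)))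
          ((volume : Measure (EuclideanSpace ℝ (Fin n))).toSphere) →
        (∫ z : sphere (0 : EuclideanSpace ℝ (Fin n)) 1, Ω (z : EuclideanSpace ℝ (Fin n))
            ∂((volume : Measure (EuclideanSpace ℝ (Fin n))).toSphere)) = 0 →
      ∀ (f : EuclideanSpace ℝ (Fin n) → ℝ), Differentiable ℝ f →
        morreyNorm n α (α * n / β) (fun y => ‖fderiv ℝ f y‖) < ∞ →
        (∫⁻ y, ENNReal.ofReal (‖fderiv ℝ f y‖ ^ p)) < ∞ →
      ∀ (g : EuclideanSpace ℝ (Fin n) → ℝ),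
        (∀ x, Tendsto (fun t : ℝ =>
            ∫ y in {y : EuclideanSpace ℝ (Fin n) | t < ‖y‖}, (Ω y / ‖y‖ ^ n) * f (x - y))
          (nhdsWithin 0 (Ioi 0)) (nhds (g x))) →
        (∫⁻ x, ENNReal.ofReal (|g x| ^ q)) ^ (1 / q) ≤
          ENNReal.ofReal C *
            ((∫⁻ z : sphere (0 : EuclideanSpace ℝ (Fin n)) 1,
                ENNReal.ofReal (|Ω (z : EuclideanSpace ℝ (Fin n))| ^ ρ)
                ∂((volume : Measure (EuclideanSpace ℝ (Fin n))).toSphere)) ^ (1 / ρ)) *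
            (morreyNorm n α (α * n / β) (fun y => ‖fderiv ℝ f y‖)) ^ (α / β) *
            ((∫⁻ y, ENNReal.ofReal (‖fderiv ℝ f y‖ ^ p)) ^ (1 / p)) ^ (1 - α / β) := by
  have hα0 : 0 < α := by linarith
  have hβ0 : 0 < β := by linarith
  have hn0 : (0 : ℝ) < n := by linarith
  have hρ0 : 0 < ρ := by linarith
  have hθ : 0 < 1 - α / β := sub_pos.2 ((div_lt_one hβ0).2 hαβ)
  have hp0 : 0 < p := by linarith
  have hq0 : 0 < q := hq ▸ div_pos hp0 hθ
  have hpq : p = q * (1 - α / β) := by rw [hq, div_mul_cancel₀ _ hθ.ne']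
  have hfin : Module.finrank ℝ (EuclideanSpace ℝ (Fin n)) = n := finrank_euclideanSpace_fin
  have : Nontrivial (EuclideanSpace ℝ (Fin n)) :=
    Module.nontrivial_of_finrank_pos (R := ℝ) (by omega)
  have hαn : 1 / (n : ℝ) < 1 / α := one_div_lt_one_div_of_lt hα0 (hαβ.trans hβ)
  have hα1 : 1 / α < 1 := (div_lt_one hα0).2 hα
  have hn1 : 0 < 1 / (n : ℝ) := by positivity
  have hσ1 : 1 < 1 / (1 / α - 1 / n) := (one_lt_div (by linarith)).2 (by linarith)
  set σ : ℝ := 1 / (1 / α - 1 / n) with hσ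
  have hσ' : 1 / σ = 1 / α - 1 / n := by rw [hσ, one_div_one_div]
  have hτ : σ.conjExponent.HolderConjugate σ := (Real.HolderConjugate.conjExponent hσ1).symm
  set τ : ℝ := σ.conjExponent
  have hτρ : τ ≤ ρ := by
    have h1 : 1 / τ = 1 - 1 / α + 1 / n := by
      have := hτ.inv_add_inv_eq_one
      simp only [one_div] at hσ' ⊢
      linarith
    have hden : 0 < ρ * n + ρ - n := by nlinarith
    have h2 : 1 / α ≤ (ρ * n + ρ - n) / (ρ * n) :=
      (one_div_le_one_div_of_le (by positivity) hα₁).trans_eq (one_div_div _ _)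
    have h3 : (ρ * n + ρ - n) / (ρ * n) = 1 + 1 / n - 1 / ρ := by field_simp
    exact (one_div_le_one_div hρ0 hτ.pos).1 (by linarith)
  obtain ⟨C, hC, hpt⟩ := exists_enorm_singularIntegral_le
    (volume : Measure (EuclideanSpace ℝ (Fin n))) hα hαβ (by rw [hfin]; linarith)
    (by rw [hfin]; exact hσ') hτ
  obtain ⟨K, hK, hLq⟩ := rpow_lintegral_rpow_le_of_le_maximalFunction
    (volume : Measure (EuclideanSpace ℝ (Fin n))) hα0 hαp hq0 hpq
  set ν := (volume : Measure (EuclideanSpace ℝ (Fin n))).toSphere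
  set V := ν univ ^ (1 / τ - 1 / ρ)
  have hV : V ≠ ∞ := ENNReal.rpow_ne_top_of_nonneg
    (sub_nonneg.2 (one_div_le_one_div_of_le hτ.pos hτρ)) (measure_ne_top ν univ)
  have hB : K * C * V ≠ ∞ := by finiteness
  refine ⟨(K * C * V).toReal + 1, by positivity, fun Ω hΩ hhom hΩi hΩ0 f hf _ _ g hg => ?_⟩
  have habs : ∀ (t s : ℝ), 0 ≤ s → ENNReal.ofReal (|t| ^ s) = ‖t‖ₑ ^ s := fun t s hs => by
    rw [← ENNReal.ofReal_rpow_of_nonneg (abs_nonneg t) hs, ← Real.enorm_eq_ofReal_abs]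
  have hnorm : ∀ y, ENNReal.ofReal (‖fderiv ℝ f y‖ ^ p) = ‖fderiv ℝ f y‖ₑ ^ p := fun y => by
    rw [← ENNReal.ofReal_rpow_of_nonneg (norm_nonneg _) hp0.le, ofReal_norm]
  simp_rw [habs _ _ hq0.le, habs _ _ hρ0.le, hnorm]
  set N := morreyNorm n α (α * n / β) (fun y => ‖fderiv ℝ f y‖) with hN
  have hmorrey : ∀ (x : EuclideanSpace ℝ (Fin n)) (r : ℝ), 0 < r →
      (ENNReal.ofReal (r ^ (β - n)) * ∫⁻ v in ball x r, ‖fderiv ℝ f v‖ₑ ^ α) ^ (1 / α) ≤ N := by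
    intro x r hr
    rw [hN, morreyNorm]
    refine le_iSup_of_le x (le_iSup_of_le r (le_iSup_of_le hr (le_of_eq ?_)))
    simp_rw [habs _ _ hα0.le, enorm_norm]
    rw [show β - n = -(n * (1 - α / (α * n / β))) by field_simp; ring]
  set W := (∫⁻ z : sphere (0 : EuclideanSpace ℝ (Fin n)) 1, ‖Ω z‖ₑ ^ ρ ∂ν) ^ (1 / ρ)
  have hW : (∫⁻ z : sphere (0 : EuclideanSpace ℝ (Fin n)) 1, ‖Ω z‖ₑ ^ τ ∂ν) ^ (1 / τ) ≤ W * V :=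
    lintegral_enorm_rpow_le_of_measure_univ ν hτ.pos hτρ (hΩ.comp measurable_subtype_coe)
  have hfinal := hLq (fun v => ‖fderiv ℝ f v‖ₑ) (measurable_fderiv ℝ f).enorm (fun x => ‖g x‖ₑ)
    (C * (W * V) * N ^ (α / β)) fun x => by
      have h := hpt Ω hΩ hhom hΩi hΩ0 f hf x N
        (fun r hr => by rw [hfin]; exact hmorrey x r hr) (g x) (by rw [hfin]; exact hg x)
      rw [mul_comm _ (N ^ (α / β)), ← mul_assoc] at h
      exact h.trans (by gcongr)
  refine hfinal.trans ?_
  have hBC : K * C * V ≤ ENNReal.ofReal ((K * C * V).toReal + 1) := by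
    rw [ENNReal.le_ofReal_iff_toReal_le hB (by positivity)]
    linarith
  calc _ = K * C * V * W * N ^ (α / β) *
        ((∫⁻ y, ‖fderiv ℝ f y‖ₑ ^ p) ^ (1 / p)) ^ (1 - α / β) := by ring
    _ ≤ _ := by gcongr
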